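/- Let a, t₅ ∈ ℝ with a < t₅ and let C > 0. Then there is no differentiable function y : [t₅, ∞) → ℝ with y(t₅) > 0 satisfying the differential inequality y′(t) ≥ (C/(t − a)) · y(t)² for all t ≥ t₅. In other words, every solution of this differential inequality with positive initial value blows up in finite time. -/

import Mathlib

open Set

/-- A function on `[t₀, ∞)` with nonnegative derivative
stays positive if it starts positive. -/
lemma pos_of_hasDerivWithinAt_nonneg {t₀ : ℝ} {y y' : ℝ → ℝ}
    (hderiv : ∀ t ∈ Ici t₀, HasDerivWithinAt y (y' t) (Ici t₀) t)
    (hnonneg : ∀ t ∈ Ici t₀, 0 ≤ y' t) (hpos : 0 < y t₀) {t : ℝ} (ht : t ∈ Ici t₀) :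
    0 < y t := by
  have hmono : MonotoneOn y (Ici t₀) :=
    monotoneOn_of_hasDerivWithinAt_nonneg (convex_Ici t₀)
      (fun s hs ↦ (hderiv s hs).continuousWithinAt)
      (fun s hs ↦ (hderiv s (interior_subset hs)).mono interior_subset)
      (fun s hs ↦ hnonneg s (interior_subset hs))
  exact hpos.trans_le (hmono self_mem_Ici ht ht)

/-- Let `a < t₅` and `C > 0`. There is no differentiable function
`y : [t₅, ∞) → ℝ` with `y(t₅) > 0` satisfying
`y′(t) ≥ (C/(t − a)) y(t)²` for all `t ≥ t₅`: every such solution blows up in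
finite time. -/
theorem no_global_solution_of_singular_riccati_inequality
    (a t₅ C : ℝ) (ha : a < t₅) (hC : 0 < C)
    (y y' : ℝ → ℝ)
    (hderiv : ∀ t ∈ Ici t₅, HasDerivWithinAt y (y' t) (Ici t₅) t)
    (hpos : 0 < y t₅)
    (hineq : ∀ t ∈ Ici t₅, y' t ≥ (C / (t - a)) * (y t) ^ 2) :
    False := by
  have hsub : ∀ t ∈ Ici t₅, 0 < t - a := fun t ht ↦ sub_pos.2 (ha.trans_le ht)
  have hy : ∀ t ∈ Ici t₅, 0 < y t := fun t ht ↦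
    pos_of_hasDerivWithinAt_nonneg hderiv
      (fun s hs ↦ le_trans (by have := hsub s hs; positivity) (hineq s hs)) hpos ht
  have hg : ∀ t ∈ Ici t₅, HasDerivWithinAt (fun s ↦ (y s)⁻¹ + C * Real.log (s - a))
      (-y' t / y t ^ 2 + C * (1 / (t - a))) (Ici t₅) t := fun t ht ↦
    ((hderiv t ht).fun_inv (hy t ht).ne').add
      ((((hasDerivWithinAt_id t _).sub_const a).log (hsub t ht).ne').const_mul C)
  have hanti : AntitoneOn (fun s ↦ (y s)⁻¹ + C * Real.log (s - a)) (Ici t₅) := by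
    refine antitoneOn_of_hasDerivWithinAt_nonpos (convex_Ici t₅)
      (fun t ht ↦ (hg t ht).continuousWithinAt)
      (fun t ht ↦ (hg t (interior_subset ht)).mono interior_subset) fun t ht ↦ ?_
    have ht := interior_subset ht
    have hle : C / (t - a) ≤ y' t / y t ^ 2 :=
      (le_div_iff₀ (pow_pos (hy t ht) 2)).2 (hineq t ht)
    rw [neg_div, mul_one_div]
    linarith
  have hlim : Filter.Tendsto (fun t ↦ C * Real.log (t - a)) Filter.atTop Filter.atTop :=
    (Real.tendsto_log_atTop.comp (Filter.tendsto_atTop_add_const_right _ (-a)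
      Filter.tendsto_id)).const_mul_atTop hC
  obtain ⟨t, hlarge, ht⟩ :=
    ((hlim.eventually_gt_atTop ((y t₅)⁻¹ + C * Real.log (t₅ - a))).and
      (Filter.eventually_ge_atTop t₅)).exists
  have hle := hanti self_mem_Ici ht ht
  have := inv_pos.2 (hy t ht)
  dsimp only at hle
  linarith
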